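/- arXiv:1710.02037 — 3 statements merged into one kernel-verified Lean document; each statement's English description precedes it below -/
import Mathlib

section
/- Let d ≥ 2 and D ∈ ℝ. Define m : [-D²/d, π²/d) → ℝ by: m(λ) = 0 if dλ = -D²; m(λ) = |ln(((e^{√(dμ)}/√(-C_-) + 1)(-1/√(-C_-) + 1))/((1 - e^{√(dμ)}/√(-C_-))(1 + 1/√(-C_-))))| if -D²/d < λ < 0 (with μ = -λ, C_- = (e^{2√(dμ)} - e^{D+√(dμ)})/(e^{D+√(dμ)} - 1)); m(0) = |D|; and m(λ) = |ln((tan(C_+ + √(dλ)) + sec(C_+ + √(dλ)))/(tan C_+ + sec C_+))| if 0 < λ < π²/d (with C_+ = arctan((cos√(dλ) - e^D)/sin√(dλ))). Then m is continuous on [-D²/d, π²/d), lim_{λ → (π²/d)⁻} m(λ) = +∞, and m(-D²/d) = 0; hence m is surjective onto [0, ∞). -/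
open Real Set

noncomputable def mFun (d : ℕ) (D : ℝ) : ℝ → ℝ := fun lam =>
  if lam < 0 then
    if (d : ℝ) * lam = -D ^ 2 then 0
    else
      |Real.log
        (((Real.exp (Real.sqrt (d * (-lam))) /
              Real.sqrt (-((Real.exp (2 * Real.sqrt (d * (-lam))) -
                  Real.exp (D + Real.sqrt (d * (-lam)))) /
                (Real.exp (D + Real.sqrt (d * (-lam))) - 1))) + 1) *
            (-1 / Real.sqrt (-((Real.exp (2 * Real.sqrt (d * (-lam))) -
                  Real.exp (D + Real.sqrt (d * (-lam)))) /
                (Real.exp (D + Real.sqrt (d * (-lam))) - 1))) + 1)) /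
          ((1 - Real.exp (Real.sqrt (d * (-lam))) /
              Real.sqrt (-((Real.exp (2 * Real.sqrt (d * (-lam))) -
                  Real.exp (D + Real.sqrt (d * (-lam)))) /
                (Real.exp (D + Real.sqrt (d * (-lam))) - 1)))) *
            (1 + 1 / Real.sqrt (-((Real.exp (2 * Real.sqrt (d * (-lam))) -
                  Real.exp (D + Real.sqrt (d * (-lam)))) /
                (Real.exp (D + Real.sqrt (d * (-lam))) - 1))))))|
  else if lam = 0 then |D|
  else
    |Real.log
      ((Real.tan (Real.arctan ((Real.cos (Real.sqrt (d * lam)) - Real.exp D) /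
            Real.sin (Real.sqrt (d * lam))) + Real.sqrt (d * lam)) +
          1 / Real.cos (Real.arctan ((Real.cos (Real.sqrt (d * lam)) - Real.exp D) /
            Real.sin (Real.sqrt (d * lam))) + Real.sqrt (d * lam))) /
        (Real.tan (Real.arctan ((Real.cos (Real.sqrt (d * lam)) - Real.exp D) /
            Real.sin (Real.sqrt (d * lam)))) +
          1 / Real.cos (Real.arctan ((Real.cos (Real.sqrt (d * lam)) - Real.exp D) /
            Real.sin (Real.sqrt (d * lam))))))|

lemma tendsto_arcosh_atTop : Filter.Tendsto arcosh Filter.atTop Filter.atTop := by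
  refine Filter.tendsto_atTop_mono' _ ?_ Real.tendsto_log_atTop
  filter_upwards [Filter.eventually_gt_atTop 0] with x hx
  exact Real.log_le_log hx (le_add_of_nonneg_right (Real.sqrt_nonneg _))

lemma abs_log_eq_arcosh {R : ℝ} (hR : 0 < R) : |Real.log R| = arcosh ((R + R⁻¹) / 2) := by
  rw [← Real.cosh_log hR, ← Real.cosh_abs, arcosh_cosh (abs_nonneg _)]

/-- The common continuation of `cos √x` for `0 ≤ x` and `cosh √(-x)` for `x ≤ 0`. -/
noncomputable def cosSqrt (x : ℝ) : ℝ := Real.cos (Real.sqrt x) * Real.cosh (Real.sqrt (-x))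

lemma continuous_cosSqrt : Continuous cosSqrt := by
  unfold cosSqrt
  fun_prop

lemma cosSqrt_of_nonneg {x : ℝ} (hx : 0 ≤ x) : cosSqrt x = Real.cos (Real.sqrt x) := by
  simp [cosSqrt, Real.sqrt_eq_zero_of_nonpos (neg_nonpos.2 hx)]

lemma cosSqrt_of_nonpos {x : ℝ} (hx : x ≤ 0) : cosSqrt x = Real.cosh (Real.sqrt (-x)) := by
  simp [cosSqrt, Real.sqrt_eq_zero_of_nonpos hx]

lemma neg_one_lt_cosSqrt {x : ℝ} (hx : x < π ^ 2) : -1 < cosSqrt x := by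
  rcases le_total x 0 with h | h
  · rw [cosSqrt_of_nonpos h]
    linarith [Real.cosh_pos (Real.sqrt (-x))]
  · rw [cosSqrt_of_nonneg h, ← Real.cos_pi]
    exact Real.cos_lt_cos_of_nonneg_of_le_pi (Real.sqrt_nonneg x) le_rfl
      ((Real.sqrt_lt' Real.pi_pos).2 hx)

lemma cosSqrt_le_cosh {x D : ℝ} (hx : -D ^ 2 ≤ x) : cosSqrt x ≤ Real.cosh D := by
  rcases le_total x 0 with h | h
  · rw [cosSqrt_of_nonpos h, Real.cosh_le_cosh, abs_of_nonneg (Real.sqrt_nonneg _)]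
    exact Real.sqrt_le_iff.2 ⟨abs_nonneg _, by rw [sq_abs]; linarith⟩
  · rw [cosSqrt_of_nonneg h]
    exact (Real.cos_le_one _).trans (Real.one_le_cosh D)

lemma cosSqrt_neg_sq (D : ℝ) : cosSqrt (-D ^ 2) = Real.cosh D := by
  rw [cosSqrt_of_nonpos (by nlinarith [sq_nonneg D]), neg_neg, Real.sqrt_sq_eq_abs, Real.cosh_abs]

lemma cosSqrt_pi_sq : cosSqrt (π ^ 2) = -1 := by
  rw [cosSqrt_of_nonneg (sq_nonneg _), Real.sqrt_sq Real.pi_pos.le, Real.cos_pi]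

lemma abs_log_hyperbolic {x E r : ℝ} (hx : 1 < x) (hE : 0 < E) (hr : 0 < r)
    (h : E * x * (1 - r ^ 2) = x ^ 2 - r ^ 2) :
    |Real.log (((x / r + 1) * (-1 / r + 1)) / ((1 - x / r) * (1 + 1 / r)))| =
      arcosh (2 * ((E + E⁻¹) / 2 + 1) / (1 + (x + x⁻¹) / 2) - 1) := by
  have hx0 : 0 < x := by linarith
  have hrx : r ≠ x := by
    rintro rfl
    have : E * r * (1 - r ^ 2) < 0 := mul_neg_of_pos_of_neg (by positivity) (by nlinarith)
    linarith
  have hrx' : r - x ≠ 0 := sub_ne_zero.2 hrx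
  have hquot : ((x / r + 1) * (-1 / r + 1)) / ((1 - x / r) * (1 + 1 / r)) =
      (x + r) ^ 2 / ((1 + r) ^ 2 * (E * x)) := by
    have h1 : 1 - x / r ≠ 0 := by
      rw [one_sub_div hr.ne']
      exact div_ne_zero hrx' hr.ne'
    rw [div_eq_div_iff (by positivity) (by positivity)]
    field_simp
    linear_combination -(1 + r) * h
  have hsum : ((x + r) ^ 2 + (1 + r) ^ 2 * (E * x)) * (x + 1) =
      2 * (E + 1) * x * (x + r) * (1 + r) := by
    linear_combination (1 - x) * h
  rw [hquot, abs_log_eq_arcosh (by positivity)]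
  congr 1
  have h2 : ((x + r) ^ 2 / ((1 + r) ^ 2 * (E * x)) +
      ((x + r) ^ 2 / ((1 + r) ^ 2 * (E * x)))⁻¹) / 2 + 1 =
      (((x + r) ^ 2 + (1 + r) ^ 2 * (E * x)) * (x + 1)) ^ 2 /
        (2 * (x + r) ^ 2 * (1 + r) ^ 2 * (E * x) * (x + 1) ^ 2) := by
    field_simp
    ring
  rw [eq_sub_iff_add_eq, h2, hsum]
  have h3 : 1 + (x + x⁻¹) / 2 = (x + 1) ^ 2 / (2 * x) := by
    field_simp
    ring
  rw [h3]
  field_simp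
  ring

lemma abs_log_trigonometric {s E : ℝ} (hs : 0 < s) (hs' : s < π) (hE : 0 < E) :
    |Real.log
      ((Real.tan (Real.arctan ((Real.cos s - E) / Real.sin s) + s) +
          1 / Real.cos (Real.arctan ((Real.cos s - E) / Real.sin s) + s)) /
        (Real.tan (Real.arctan ((Real.cos s - E) / Real.sin s)) +
          1 / Real.cos (Real.arctan ((Real.cos s - E) / Real.sin s))))| =
      arcosh (2 * ((E + E⁻¹) / 2 + 1) / (1 + Real.cos s) - 1) := by
  have hsin : 0 < Real.sin s := Real.sin_pos_of_pos_of_lt_pi hs hs'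
  have hcos : 0 < 1 + Real.cos s := by
    have := Real.cos_lt_cos_of_nonneg_of_le_pi hs.le le_rfl hs'
    rw [Real.cos_pi] at this
    linarith
  rw [Real.tan_eq_sin_div_cos (_ + s), Real.sin_add, Real.cos_add, Real.tan_arctan,
    Real.sin_arctan, Real.cos_arctan]
  have hsc := Real.sin_sq_add_cos_sq s
  generalize Real.sin s = a at *
  generalize Real.cos s = c at *
  have hw : 0 < √(1 + ((c - E) / a) ^ 2) := Real.sqrt_pos.2 (by positivity)
  have hw2 : √(1 + ((c - E) / a) ^ 2) ^ 2 = 1 + ((c - E) / a) ^ 2 :=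
    Real.sq_sqrt (by positivity)
  generalize √(1 + ((c - E) / a) ^ 2) = w at *
  have hq : (w * a) ^ 2 = a ^ 2 + (c - E) ^ 2 := by
    rw [mul_pow, hw2]
    field_simp
  have hq0 : 0 < w * a := by positivity
  have hpos1 : 0 < c - E + w * a := by
    have := abs_lt_of_sq_lt_sq (a := c - E) (b := w * a) (by nlinarith) hq0.le
    linarith [(abs_lt.1 this).1]
  have hpos2 : 0 < 1 - E * c + w * a := by
    have := abs_lt_of_sq_lt_sq (a := 1 - E * c) (b := w * a)
      (by nlinarith [mul_pos (pow_pos hE 2) (pow_pos hsin 2)]) hq0.le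
    linarith [(abs_lt.1 this).1]
  have hcosadd : 1 / w * c - (c - E) / a / w * a = E / w := by
    field_simp
    ring
  have hsinadd : (c - E) / a / w * c + 1 / w * a = (1 - E * c) / (w * a) := by
    field_simp
    linear_combination hsc
  have hquot : (((c - E) / a / w * c + 1 / w * a) / (1 / w * c - (c - E) / a / w * a) +
      1 / (1 / w * c - (c - E) / a / w * a)) / ((c - E) / a + 1 / (1 / w)) =
      (1 - E * c + w * a) / (E * (c - E + w * a)) := by
    rw [hcosadd, hsinadd]
    have : (c - E) / a + 1 / (1 / w) = (c - E + w * a) / a := by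
      field_simp
    rw [this]
    field_simp
  rw [hquot, abs_log_eq_arcosh (by positivity)]
  congr 1
  generalize w * a = q at *
  have ha : a ^ 2 = 1 - c ^ 2 := by linarith
  rw [ha] at hq
  have hd := hpos1.ne'
  have hn := hpos2.ne'
  field_simp
  linear_combination ((1 + E ^ 2) * (1 + c) - 2 * (E ^ 2 + 1 + E - E * c)) * hq

lemma mFun_eq_arcosh {d : ℕ} (hd : 0 < d) {D x : ℝ}
    (hx : x ∈ Ico (-D ^ 2 / d) (π ^ 2 / d)) :
    mFun d D x = arcosh (2 * (Real.cosh D + 1) / (1 + cosSqrt (d * x)) - 1) := by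
  have hd' : (0 : ℝ) < d := Nat.cast_pos.2 hd
  have hx1 : -D ^ 2 ≤ d * x := by
    have := (div_le_iff₀ hd').1 hx.1
    linarith
  have hx2 : d * x < π ^ 2 := by
    have := (lt_div_iff₀ hd').1 hx.2
    linarith
  have hcoshD := Real.cosh_pos D
  unfold mFun
  split_ifs with h1 h2 h3
  · rw [h2, cosSqrt_neg_sq, add_comm 1, mul_div_assoc, div_self (by positivity)]
    norm_num
  · have hlt : -D ^ 2 < d * x := lt_of_le_of_ne hx1 (Ne.symm h2)
    have hneg : d * x < 0 := mul_neg_of_pos_of_neg hd' h1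
    rw [cosSqrt_of_nonpos hneg.le, mul_neg]
    have hs : 0 < √(-(d * x)) := Real.sqrt_pos.2 (by linarith)
    have hsD : √(-(d * x)) < |D| := (Real.sqrt_lt' (hs.trans_le (Real.sqrt_le_iff.2
      ⟨abs_nonneg _, by rw [sq_abs]; linarith⟩))).2 (by rw [sq_abs]; linarith)
    generalize √(-(d * x)) = s at *
    rw [Real.cosh_eq, Real.cosh_eq, Real.exp_neg, Real.exp_neg, two_mul s, Real.exp_add,
      Real.exp_add]
    have hx' : 1 < Real.exp s := Real.one_lt_exp_iff.2 hs
    have hE : 0 < Real.exp D := Real.exp_pos D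
    have hc : 0 < -((Real.exp s * Real.exp s - Real.exp D * Real.exp s) /
        (Real.exp D * Real.exp s - 1)) ∧ Real.exp D * Real.exp s - 1 ≠ 0 := by
      have hxE : Real.exp s * Real.exp s - Real.exp D * Real.exp s =
          Real.exp s * (Real.exp s - Real.exp D) := by ring
      rw [hxE, ← Real.exp_add]
      rcases lt_abs.1 hsD with h | h
      · have a1 : Real.exp s < Real.exp D := Real.exp_lt_exp.2 h
        have a2 : 1 < Real.exp (D + s) := Real.one_lt_exp_iff.2 (by linarith)
        refine ⟨?_, by linarith⟩
        rw [neg_pos]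
        exact div_neg_of_neg_of_pos
          (mul_neg_of_pos_of_neg (Real.exp_pos s) (by linarith)) (by linarith)
      · have a1 : Real.exp D < Real.exp s := Real.exp_lt_exp.2 (by linarith)
        have a2 : Real.exp (D + s) < 1 := Real.exp_lt_one_iff.2 (by linarith)
        refine ⟨?_, by linarith⟩
        rw [neg_pos]
        exact div_neg_of_pos_of_neg
          (mul_pos (Real.exp_pos s) (by linarith)) (by linarith)
    generalize Real.exp s = X at *
    generalize Real.exp D = E at *
    refine abs_log_hyperbolic hx' hE (Real.sqrt_pos.2 hc.1) ?_
    rw [Real.sq_sqrt hc.1.le]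
    have := hc.2
    field_simp
    ring
  · subst h3
    rw [mul_zero, cosSqrt_of_nonneg le_rfl, Real.sqrt_zero, Real.cos_zero]
    rw [show 2 * (Real.cosh D + 1) / (1 + 1) - 1 = Real.cosh |D| by rw [Real.cosh_abs]; ring,
      arcosh_cosh (abs_nonneg D)]
  · have hpos : 0 < d * x := mul_pos hd' (lt_of_le_of_ne (not_lt.1 h1) (Ne.symm h3))
    rw [cosSqrt_of_nonneg hpos.le, Real.cosh_eq, Real.exp_neg]
    exact abs_log_trigonometric (Real.sqrt_pos.2 hpos) ((Real.sqrt_lt' Real.pi_pos).2 hx2)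
      (Real.exp_pos D)

theorem stmt_9 (d : ℕ) (hd : 2 ≤ d) (D : ℝ) :
    ContinuousOn (mFun d D) (Set.Ico (-D ^ 2 / d) (Real.pi ^ 2 / d)) ∧
    Filter.Tendsto (mFun d D)
      (nhdsWithin (Real.pi ^ 2 / d) (Set.Iio (Real.pi ^ 2 / d))) Filter.atTop ∧
    mFun d D (-D ^ 2 / d) = 0 ∧
    Set.Ici (0 : ℝ) ⊆ mFun d D '' Set.Ico (-D ^ 2 / d) (Real.pi ^ 2 / d) := by
  have hd0 : 0 < d := by omega
  have hd' : (0 : ℝ) < d := Nat.cast_pos.2 hd0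
  have hlt : -D ^ 2 / d < π ^ 2 / d :=
    div_lt_div_of_pos_right (by nlinarith [sq_nonneg D, pow_pos Real.pi_pos 2]) hd'
  have hden : ∀ x ∈ Ico (-D ^ 2 / d) (π ^ 2 / d), 0 < 1 + cosSqrt (d * x) := fun x hx => by
    have := (lt_div_iff₀' hd').1 hx.2
    linarith [neg_one_lt_cosSqrt this]
  have hcont : ContinuousOn (mFun d D) (Ico (-D ^ 2 / d) (π ^ 2 / d)) := by
    refine ContinuousOn.congr ?_ fun x hx => mFun_eq_arcosh hd0 hx
    refine continuousOn_arcosh.comp ?_ fun x hx => ?_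
    · have := continuous_cosSqrt
      exact (ContinuousOn.div (by fun_prop) (by fun_prop) fun x hx => (hden x hx).ne').sub
        continuousOn_const
    · have h1 : cosSqrt (d * x) ≤ Real.cosh D := cosSqrt_le_cosh ((div_le_iff₀' hd').1 hx.1)
      have h2 : 1 ≤ (Real.cosh D + 1) / (1 + cosSqrt (d * x)) :=
        (one_le_div (hden x hx)).2 (by linarith)
      rw [mem_Ici, mul_div_assoc]
      linarith
  have hnear : ∀ᶠ x in nhdsWithin (π ^ 2 / d) (Iio (π ^ 2 / d)),
      x ∈ Ico (-D ^ 2 / d) (π ^ 2 / d) := Ico_mem_nhdsLT hlt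
  have htend : Filter.Tendsto (mFun d D) (nhdsWithin (π ^ 2 / d) (Iio (π ^ 2 / d)))
      Filter.atTop := by
    refine Filter.Tendsto.congr' (hnear.mono fun x hx => (mFun_eq_arcosh hd0 hx).symm) ?_
    refine tendsto_arcosh_atTop.comp (Filter.tendsto_atTop_add_const_right _ (-1) ?_)
    refine Filter.Tendsto.const_mul_atTop
      (by linarith [Real.cosh_pos D] : 0 < 2 * (Real.cosh D + 1))
      (Filter.Tendsto.inv_tendsto_nhdsGT_zero ?_)
    refine tendsto_nhdsWithin_iff.2 ⟨?_, hnear.mono hden⟩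
    have hc : Continuous fun x : ℝ => 1 + cosSqrt (d * x) := by
      have := continuous_cosSqrt
      fun_prop
    have := hc.tendsto (π ^ 2 / d)
    rw [mul_div_cancel₀ _ hd'.ne', cosSqrt_pi_sq, add_neg_cancel] at this
    exact this.mono_left nhdsWithin_le_nhds
  have hzero : mFun d D (-D ^ 2 / d) = 0 := by
    rw [mFun_eq_arcosh hd0 (left_mem_Ico.2 hlt), mul_div_cancel₀ _ hd'.ne', cosSqrt_neg_sq,
      add_comm 1, mul_div_assoc, div_self (by linarith [Real.cosh_pos D])]
    norm_num
  refine ⟨hcont, htend, hzero, fun y hy => ?_⟩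
  obtain ⟨b, hyb, hb⟩ := ((htend.eventually_ge_atTop y).and hnear).exists
  have hsub : Icc (-D ^ 2 / d) b ⊆ Ico (-D ^ 2 / d) (π ^ 2 / d) :=
    fun z hz => ⟨hz.1, hz.2.trans_lt hb.2⟩
  exact image_mono hsub (intermediate_value_Icc hb.1 (hcont.mono hsub)
    ⟨by rw [hzero]; exact hy, hyb⟩)
end

section
/- Let d ≥ 2 and let a₁,...,a_d, b₁,...,b_d be positive real numbers. Then there exists a unique pair (λ, f) with λ ∈ ℝ and f = (f₁,...,f_d) ∈ C²([0,1]; (0,∞)^d) such that: (i) Σ_i(-f_i'/f_i · Σ_k f_k'/f_k + (f_i'/f_i)²)|_{r=0} = (d-1)λ; (ii) for each i and all r ∈ [0,1], -f_i'/f_i · Σ_k f_k'/f_k + (f_i'/f_i)² - f_i''/f_i = λ; and (iii) f_i(0) = a_i, f_i(1) = b_i for each i. -/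
open Real Set

/-- The torus Einstein Dirichlet system on `[0,1]`:
`(i)` the initial-slice `rr`-equation, `(ii)` the equations in the homogeneous
directions, `(iii)` the Dirichlet boundary conditions. -/
def TorusEinstein (d : ℕ) (a b : Fin d → ℝ) (lam : ℝ) (f : Fin d → ℝ → ℝ) : Prop :=
  (∀ i, ContDiffOn ℝ 2 (f i) (Set.Icc 0 1)) ∧
  (∀ i, ∀ r ∈ Set.Icc (0:ℝ) 1, 0 < f i r) ∧
  (∑ i, (-(derivWithin (f i) (Set.Icc 0 1) 0 / f i 0) *
        (∑ k, derivWithin (f k) (Set.Icc 0 1) 0 / f k 0) +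
      (derivWithin (f i) (Set.Icc 0 1) 0 / f i 0) ^ 2)) = (d - 1) * lam ∧
  (∀ i, ∀ r ∈ Set.Icc (0:ℝ) 1,
    -(derivWithin (f i) (Set.Icc 0 1) r / f i r) *
        (∑ k, derivWithin (f k) (Set.Icc 0 1) r / f k r) +
      (derivWithin (f i) (Set.Icc 0 1) r / f i r) ^ 2 -
      derivWithin (derivWithin (f i) (Set.Icc 0 1)) (Set.Icc 0 1) r / f i r = lam) ∧
  (∀ i, f i 0 = a i) ∧ (∀ i, f i 1 = b i)

/-- A function whose derivative within `[0,1]` vanishes is constant on `[0,1]`. -/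
lemma eq_left_of_hasDerivWithinAt_zero {y : ℝ → ℝ}
    (h : ∀ r ∈ Icc (0:ℝ) 1, HasDerivWithinAt y 0 (Icc 0 1) r) :
    ∀ r ∈ Icc (0:ℝ) 1, y r = y 0 := by
  apply constant_of_derivWithin_zero
  · exact fun r hr => (h r hr).differentiableWithinAt
  · intro r hr
    exact (h r (Ico_subset_Icc_self hr)).derivWithin
      (uniqueDiffOn_Icc zero_lt_one r (Ico_subset_Icc_self hr))

/-- The derivative within `[0,1]` of a function vanishing on `[0,1]` is zero. -/
lemma hasDerivWithinAt_eq_zero_of_eqOn_zero {y : ℝ → ℝ} {y' r : ℝ} (hr : r ∈ Icc (0:ℝ) 1)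
    (h : HasDerivWithinAt y y' (Icc 0 1) r) (h0 : ∀ s ∈ Icc (0:ℝ) 1, y s = 0) : y' = 0 :=
  (uniqueDiffOn_Icc zero_lt_one r hr).eq_deriv _ h
    ((hasDerivWithinAt_const r _ (0:ℝ)).congr h0 (h0 r hr))

/-- The Dirichlet problem for `y'' = k y` (after a change of variables with density `g`)
has only the trivial solution when `k ≥ 0`. -/
lemma dirichlet_eq_zero {y z g : ℝ → ℝ} {k : ℝ} (hk : 0 ≤ k)
    (hg : ∀ r ∈ Icc (0:ℝ) 1, 0 < g r)
    (hy : ∀ r ∈ Icc (0:ℝ) 1, HasDerivWithinAt y (z r * g r) (Icc 0 1) r)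
    (hz : ∀ r ∈ Icc (0:ℝ) 1, HasDerivWithinAt z (k * y r * g r) (Icc 0 1) r)
    (h0 : y 0 = 0) (h1 : y 1 = 0) : ∀ r ∈ Icc (0:ℝ) 1, y r = 0 := by
  have hyz : ∀ r ∈ Icc (0:ℝ) 1,
      HasDerivWithinAt (fun r => y r * z r) ((z r ^ 2 + k * y r ^ 2) * g r) (Icc 0 1) r := by
    intro r hr
    refine ((hy r hr).mul (hz r hr)).congr_deriv ?_
    ring
  have hmono : MonotoneOn (fun r => y r * z r) (Icc 0 1) := by
    apply monotoneOn_of_hasDerivWithinAt_nonneg (convex_Icc 0 1)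
      (f' := fun r => (z r ^ 2 + k * y r ^ 2) * g r)
    · exact fun r hr => (hyz r hr).continuousWithinAt
    · intro r hr
      exact (hyz r (interior_subset hr)).mono interior_subset
    · intro r hr
      have := hg r (interior_subset hr)
      positivity
  have hyz0 : ∀ r ∈ Icc (0:ℝ) 1, y r * z r = 0 := by
    intro r hr
    have hl := hmono (left_mem_Icc.2 zero_le_one) hr hr.1
    have hu := hmono hr (right_mem_Icc.2 zero_le_one) hr.2
    simp only [h0, h1, zero_mul] at hl hu
    exact le_antisymm hu hl
  have hz0 : ∀ r ∈ Icc (0:ℝ) 1, z r = 0 := by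
    intro r hr
    have h := hasDerivWithinAt_eq_zero_of_eqOn_zero hr (hyz r hr) hyz0
    have h' := (mul_eq_zero.1 h).resolve_right (hg r hr).ne'
    have : z r ^ 2 = 0 := by nlinarith [sq_nonneg (z r), mul_nonneg hk (sq_nonneg (y r))]
    exact pow_eq_zero_iff two_ne_zero |>.1 this
  intro r hr
  rw [eq_left_of_hasDerivWithinAt_zero (y := y) (fun s hs => ?_) r hr, h0]
  simpa [hz0 s hs] using hy s hs

/-- Positive solution of the Dirichlet problem for `u'' = k u`. -/
lemma exists_dirichlet_solution {k α β : ℝ} (hk : 0 ≤ k) (hα : 0 < α) (hβ : 0 < β) :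
    ∃ u u' : ℝ → ℝ, (∀ s, HasDerivAt u (u' s) s) ∧ (∀ s, HasDerivAt u' (k * u s) s) ∧
      u 0 = α ∧ u 1 = β ∧ ∀ s ∈ Icc (0:ℝ) 1, 0 < u s := by
  rcases hk.eq_or_lt with rfl | hk
  · refine ⟨fun s => α + (β - α) * s, fun _ => β - α, fun s => ?_, fun s => ?_, by simp, by simp,
      fun s hs => ?_⟩
    · simpa using ((hasDerivAt_id s).const_mul (β - α)).const_add α
    · simpa using hasDerivAt_const s (β - α)
    · have : α + (β - α) * s = α * (1 - s) + β * s := by ring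
      simp only [this]
      rcases hs.1.eq_or_lt with h | h
      · subst h; simpa using hα
      · have := mul_nonneg hα.le (sub_nonneg.2 hs.2)
        positivity
  · set κ := √k with hκ
    have hκ0 : 0 < κ := sqrt_pos.2 hk
    have hκk : k = κ * κ := (mul_self_sqrt hk.le).symm
    have hs0 : 0 < sinh κ := sinh_pos_iff.2 hκ0
    have d1 : ∀ s, HasDerivAt (fun s : ℝ => κ * (1 - s)) (-κ) s := fun s => by
      simpa using ((hasDerivAt_id s).const_sub 1).const_mul κ
    have d2 : ∀ s, HasDerivAt (fun s : ℝ => κ * s) κ s := fun s => by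
      simpa using (hasDerivAt_id s).const_mul κ
    refine ⟨fun s => (α * sinh (κ * (1 - s)) + β * sinh (κ * s)) / sinh κ,
      fun s => (α * (cosh (κ * (1 - s)) * -κ) + β * (cosh (κ * s) * κ)) / sinh κ,
      fun s => ?_, fun s => ?_, ?_, ?_, fun s hs => ?_⟩
    · exact (((d1 s).sinh.const_mul α).add ((d2 s).sinh.const_mul β)).div_const _
    · refine (((((d1 s).cosh.mul_const (-κ)).const_mul α).add
        (((d2 s).cosh.mul_const κ).const_mul β)).div_const (sinh κ)).congr_deriv ?_
      rw [hκk]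
      ring
    · simp [hs0.ne']
    · simp [hs0.ne']
    · have h1 : 0 ≤ sinh (κ * (1 - s)) :=
        sinh_nonneg_iff.2 (mul_nonneg hκ0.le (sub_nonneg.2 hs.2))
      apply div_pos _ hs0
      rcases hs.1.eq_or_lt with h | h
      · subst h; simpa using mul_pos hα hs0
      · have h2 : 0 < sinh (κ * s) := sinh_pos_iff.2 (mul_pos hκ0 h)
        positivity

/-- For `u` positive on `[0,1]`, the primitive of `1/u` extends to a bijection of the line whose
inverse is a flow line of `u`. -/
lemma exists_primitive_inv {u : ℝ → ℝ} (hu : ContinuousOn u (Icc 0 1))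
    (hpos : ∀ s ∈ Icc (0:ℝ) 1, 0 < u s) :
    ∃ U V : ℝ → ℝ, U 0 = 0 ∧ StrictMono U ∧ (∀ t, U (V t) = t) ∧
      (∀ s ∈ Icc (0:ℝ) 1, HasDerivAt U (u s)⁻¹ s) ∧
      (∀ s ∈ Icc (0:ℝ) 1, HasDerivAt V (u s) (U s)) := by
  set q : ℝ → ℝ := fun s => u (projIcc (0:ℝ) 1 zero_le_one s) with hq
  have hq0 : ∀ s, 0 < q s := fun s => hpos _ (projIcc (0:ℝ) 1 zero_le_one s).2
  have hqc : Continuous q :=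
    hu.comp_continuous (continuous_subtype_val.comp continuous_projIcc) fun s =>
      (projIcc (0:ℝ) 1 zero_le_one s).2
  have hqu : ∀ s ∈ Icc (0:ℝ) 1, q s = u s := fun s hs => by
    simp [hq, projIcc_of_mem zero_le_one hs]
  have hic : Continuous fun s => (q s)⁻¹ := hqc.inv₀ fun s => (hq0 s).ne'
  set U : ℝ → ℝ := fun s => ∫ t in (0:ℝ)..s, (q t)⁻¹ with hU
  have hUd : ∀ s, HasDerivAt U (q s)⁻¹ s := fun s => hic.integral_hasStrictDerivAt 0 s |>.hasDerivAt
  have hU0 : U 0 = 0 := by simp [hU]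
  have hmono : StrictMono U :=
    strictMono_of_hasDerivAt_pos hUd fun s => inv_pos.2 (hq0 s)
  obtain ⟨M, hM0, hM⟩ : ∃ M > 0, ∀ s, q s ≤ M := by
    obtain ⟨M, hM⟩ := (isCompact_Icc (a := (0:ℝ)) (b := 1)).bddAbove_image hu
    have hle : ∀ s, q s ≤ M := fun s =>
      hM (mem_image_of_mem u (projIcc (0:ℝ) 1 zero_le_one s).2)
    exact ⟨M, (hq0 0).trans_le (hle 0), hle⟩
  have hdiff : Monotone fun s => U s - M⁻¹ * s := by
    apply monotone_of_hasDerivAt_nonneg (f' := fun s => (q s)⁻¹ - M⁻¹)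
    · intro s
      exact ((hUd s).sub ((hasDerivAt_id s).const_mul M⁻¹)).congr_deriv (by simp)
    · intro s
      exact sub_nonneg.2 (inv_anti₀ (hq0 s) (hM s))
  have hcont : Continuous U := continuous_iff_continuousAt.2 fun s => (hUd s).continuousAt
  have htop : Filter.Tendsto U Filter.atTop Filter.atTop := by
    refine Filter.tendsto_atTop_mono' _ ?_
      (Filter.tendsto_id.const_mul_atTop (inv_pos.2 hM0))
    filter_upwards [Filter.eventually_ge_atTop 0] with s hs
    have := hdiff hs
    simp only [hU0, mul_zero, sub_zero] at this
    simp only [id]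
    linarith
  have hbot : Filter.Tendsto U Filter.atBot Filter.atBot := by
    refine Filter.tendsto_atBot_mono' _ ?_
      (Filter.tendsto_id.const_mul_atBot (inv_pos.2 hM0))
    filter_upwards [Filter.eventually_le_atBot 0] with s hs
    have := hdiff hs
    simp only [hU0, mul_zero, sub_zero] at this
    simp only [id]
    linarith
  have hsurj : Function.Surjective U := hcont.surjective htop hbot
  set e := hmono.orderIsoOfSurjective U hsurj
  have hUV : ∀ t, U (e.symm t) = t := fun t => e.apply_symm_apply t
  have hVU : ∀ s, e.symm (U s) = s := fun s => e.symm_apply_apply s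
  refine ⟨U, e.symm, hU0, hmono, hUV, fun s hs => hqu s hs ▸ hUd s, fun s hs => ?_⟩
  have h := HasDerivAt.of_local_left_inverse (f := U) (g := e.symm) (a := U s)
    (f' := (q s)⁻¹) e.symm.continuous.continuousAt (by rw [hVU]; exact hUd s)
    (inv_ne_zero (hq0 s).ne') (Filter.Eventually.of_forall hUV)
  rwa [inv_inv, hqu s hs] at h

/-- First-order form of the torus Einstein equations, in terms of the logarithmic derivatives
`p i = f i' / f i`. -/
structure LogSystem (d : ℕ) (a b : Fin d → ℝ) (lam : ℝ) (f p : Fin d → ℝ → ℝ) : Prop where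
  pos : ∀ i, ∀ r ∈ Icc (0:ℝ) 1, 0 < f i r
  deriv_f : ∀ i, ∀ r ∈ Icc (0:ℝ) 1, HasDerivWithinAt (f i) (f i r * p i r) (Icc 0 1) r
  deriv_p : ∀ i, ∀ r ∈ Icc (0:ℝ) 1,
    HasDerivWithinAt (p i) (-lam - p i r * ∑ k, p k r) (Icc 0 1) r
  init : ∑ i, p i 0 ^ 2 - (∑ i, p i 0) ^ 2 = (d - 1) * lam
  left : ∀ i, f i 0 = a i
  right : ∀ i, f i 1 = b i

lemma TorusEinstein.logSystem {d : ℕ} {a b : Fin d → ℝ} {lam : ℝ} {f : Fin d → ℝ → ℝ}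
    (h : TorusEinstein d a b lam f) :
    LogSystem d a b lam f fun i r => derivWithin (f i) (Icc 0 1) r / f i r := by
  obtain ⟨hC, hpos, hi, hii, h0, h1⟩ := h
  have hU := uniqueDiffOn_Icc (zero_lt_one (α := ℝ))
  have hf : ∀ i, ∀ r ∈ Icc (0:ℝ) 1,
      HasDerivWithinAt (f i) (derivWithin (f i) (Icc 0 1) r) (Icc 0 1) r := fun i r hr =>
    ((hC i).differentiableOn two_ne_zero r hr).hasDerivWithinAt
  have hf' : ∀ i, ∀ r ∈ Icc (0:ℝ) 1, HasDerivWithinAt (derivWithin (f i) (Icc 0 1))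
      (derivWithin (derivWithin (f i) (Icc 0 1)) (Icc 0 1) r) (Icc 0 1) r := fun i r hr =>
    (((hC i).derivWithin hU (m := 1) (by norm_num)).differentiableOn
      one_ne_zero r hr).hasDerivWithinAt
  refine ⟨hpos, fun i r hr => ?_, fun i r hr => ?_, ?_, h0, h1⟩
  · refine (hf i r hr).congr_deriv ?_
    have := (hpos i r hr).ne'
    field_simp
  · refine ((hf' i r hr).div (hf i r hr) (hpos i r hr).ne').congr_deriv ?_
    rw [← hii i r hr]
    have := (hpos i r hr).ne'
    field_simp
    ring
  · rw [← hi, Finset.sum_add_distrib, ← Finset.sum_mul, Finset.sum_neg_distrib]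
    ring

lemma LogSystem.torusEinstein {d : ℕ} {a b : Fin d → ℝ} {lam : ℝ} {f p : Fin d → ℝ → ℝ}
    (h : LogSystem d a b lam f p) : TorusEinstein d a b lam f := by
  have hU := uniqueDiffOn_Icc (zero_lt_one (α := ℝ))
  have hf : ∀ i, ∀ r ∈ Icc (0:ℝ) 1, derivWithin (f i) (Icc 0 1) r = f i r * p i r :=
    fun i r hr => (h.deriv_f i r hr).derivWithin (hU r hr)
  have hf2 : ∀ i, ∀ r ∈ Icc (0:ℝ) 1, HasDerivWithinAt (derivWithin (f i) (Icc 0 1))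
      (f i r * p i r * p i r + f i r * (-lam - p i r * ∑ k, p k r)) (Icc 0 1) r :=
    fun i r hr => ((h.deriv_f i r hr).mul (h.deriv_p i r hr)).congr (hf i) (hf i r hr)
  have hlog : ∀ i, ∀ r ∈ Icc (0:ℝ) 1, derivWithin (f i) (Icc 0 1) r / f i r = p i r :=
    fun i r hr => by rw [hf i r hr, mul_div_cancel_left₀ _ (h.pos i r hr).ne']
  have hfc : ∀ i, ContinuousOn (f i) (Icc 0 1) := fun i r hr =>
    (h.deriv_f i r hr).continuousWithinAt
  have hpc : ∀ i, ContinuousOn (p i) (Icc 0 1) := fun i r hr =>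
    (h.deriv_p i r hr).continuousWithinAt
  refine ⟨fun i => ?_, h.pos, ?_, fun i r hr => ?_, h.left, h.right⟩
  · rw [show (2 : WithTop ℕ∞) = 1 + 1 by norm_num, contDiffOn_succ_iff_derivWithin hU]
    refine ⟨fun r hr => (h.deriv_f i r hr).differentiableWithinAt, by simp, ?_⟩
    rw [show (1 : WithTop ℕ∞) = 0 + 1 by norm_num, contDiffOn_succ_iff_derivWithin hU]
    refine ⟨fun r hr => (hf2 i r hr).differentiableWithinAt, by simp, ?_⟩
    rw [contDiffOn_zero]
    have hc : ContinuousOn (fun r => f i r * p i r * p i r +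
        f i r * (-lam - p i r * ∑ k, p k r)) (Icc 0 1) :=
      (((hfc i).mul (hpc i)).mul (hpc i)).add ((hfc i).mul (continuousOn_const.sub
        ((hpc i).mul (continuousOn_finsetSum _ fun k _ => hpc k))))
    exact hc.congr fun r hr => (hf2 i r hr).derivWithin (hU r hr)
  · have h0 : (0:ℝ) ∈ Icc (0:ℝ) 1 := left_mem_Icc.2 zero_le_one
    simp only [hlog _ 0 h0]
    rw [← h.init, Finset.sum_add_distrib, ← Finset.sum_mul, Finset.sum_neg_distrib]
    ring
  · simp only [hlog _ r hr]
    rw [(hf2 i r hr).derivWithin (hU r hr)]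
    have := (h.pos i r hr).ne'
    field_simp
    ring

/-- The deviation of `log b i - log a i` from its mean. -/
noncomputable def logDev {d : ℕ} (a b : Fin d → ℝ) (i : Fin d) : ℝ :=
  log (b i) - log (a i) - (∑ k, log (b k) - ∑ k, log (a k)) / d

/-- The rate of the linear equation satisfied by the inverse volume density. -/
noncomputable def volRate {d : ℕ} (a b : Fin d → ℝ) : ℝ :=
  d / (d - 1) * ∑ i, logDev a b i ^ 2

lemma sum_logDev {d : ℕ} (hd : d ≠ 0) (a b : Fin d → ℝ) : ∑ i, logDev a b i = 0 := by
  have : (d : ℝ) ≠ 0 := Nat.cast_ne_zero.2 hd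
  simp only [logDev, Finset.sum_sub_distrib, Finset.sum_const, Finset.card_univ, Fintype.card_fin,
    nsmul_eq_mul]
  field_simp
  ring

lemma volRate_nonneg {d : ℕ} (hd : 2 ≤ d) (a b : Fin d → ℝ) : 0 ≤ volRate a b := by
  have : (2:ℝ) ≤ d := by exact_mod_cast hd
  exact mul_nonneg (div_nonneg (by linarith) (by linarith))
    (Finset.sum_nonneg fun i _ => sq_nonneg _)

/-- Sum of squares in terms of the trace-free part. -/
lemma sum_sq_add_const {d : ℕ} (l : Fin d → ℝ) (hl : ∑ i, l i = 0) (c x : ℝ) :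
    ∑ i, (c + l i * x) ^ 2 = d * c ^ 2 + (∑ i, l i ^ 2) * x ^ 2 := by
  have : ∀ i, (c + l i * x) ^ 2 = c ^ 2 + l i * (2 * c * x) + l i ^ 2 * x ^ 2 := fun i => by ring
  simp only [this, Finset.sum_add_distrib, ← Finset.sum_mul, hl, Finset.sum_const,
    Finset.card_univ, Fintype.card_fin, nsmul_eq_mul]
  ring

lemma exists_logSystem {d : ℕ} (hd : 2 ≤ d) {a b : Fin d → ℝ}
    (ha : ∀ i, 0 < a i) (hb : ∀ i, 0 < b i) : ∃ lam f p, LogSystem d a b lam f p := by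
  have hd2 : (2:ℝ) ≤ d := by exact_mod_cast hd
  have hd0 : (d:ℝ) ≠ 0 := by linarith
  have hd1 : (d:ℝ) - 1 ≠ 0 := by linarith
  obtain ⟨u, v, hu, hv, hu0, hu1, hpos⟩ := exists_dirichlet_solution (volRate_nonneg hd a b)
    (exp_pos (-∑ k, log (a k))) (exp_pos (-∑ k, log (b k)))
  obtain ⟨U, V, hU0, hmono, hUV, -, hVd⟩ := exists_primitive_inv
    (fun s _ => (hu s).continuousAt.continuousWithinAt) hpos
  set k := volRate a b with hk
  set l := logDev a b with hl
  have hl0 : ∑ i, l i = 0 := sum_logDev (by omega) a b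
  have hkl : ∑ i, l i ^ 2 = (d - 1) / d * k := by
    rw [hk, volRate]
    field_simp
    rfl
  have hVU : ∀ s, V (U s) = s := fun s => hmono.injective (hUV _)
  have hV0 : V 0 = 0 := by simpa [hU0] using hVU 0
  set σ : ℝ → ℝ := fun r => V (r * U 1) with hσ
  have hσ0 : σ 0 = 0 := by simp [hσ, hV0]
  have hσ1 : σ 1 = 1 := by simp [hσ, hVU]
  have hU1 : 0 < U 1 := hU0 ▸ hmono zero_lt_one
  have hσI : ∀ r ∈ Icc (0:ℝ) 1, σ r ∈ Icc (0:ℝ) 1 := by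
    intro r hr
    constructor
    · rw [← hmono.le_iff_le, hU0, hUV]
      exact mul_nonneg hr.1 hU1.le
    · rw [← hmono.le_iff_le, hUV]
      exact mul_le_of_le_one_left hU1.le hr.2
  have hσd : ∀ r ∈ Icc (0:ℝ) 1, HasDerivAt σ (U 1 * u (σ r)) r := by
    intro r hr
    have h1 := hVd (σ r) (hσI r hr)
    rw [hUV] at h1
    have h2 : HasDerivAt (fun r : ℝ => r * U 1) (U 1) r := by
      simpa using (hasDerivAt_id r).mul_const (U 1)
    rw [mul_comm]
    exact h1.comp r h2
  have hcons : ∀ s, k * u s ^ 2 - v s ^ 2 = k * u 0 ^ 2 - v 0 ^ 2 := by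
    intro s
    refine is_const_of_deriv_eq_zero (f := fun s => k * u s ^ 2 - v s ^ 2)
      (fun s => ?_) (fun s => ?_) s 0
    · exact ((((hu s).pow 2).const_mul k).sub ((hv s).pow 2)).differentiableAt
    · refine HasDerivAt.deriv ?_
      refine ((((hu s).pow 2).const_mul k).sub ((hv s).pow 2)).congr_deriv ?_
      simp
      ring
  set e := U 1 with he
  have hsum : ∀ r, ∑ i, e * (-v (σ r) / d + l i * u (σ r)) = -e * v (σ r) := by
    intro r
    rw [← Finset.mul_sum, Finset.sum_add_distrib, ← Finset.sum_mul, hl0, Finset.sum_const,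
      Finset.card_univ, Fintype.card_fin, nsmul_eq_mul]
    field_simp
    ring
  refine ⟨e ^ 2 * (k * u 0 ^ 2 - v 0 ^ 2) / d,
    fun i r => exp (log (a i) - (log (u (σ r)) + ∑ k, log (a k)) / d + l i * σ r),
    fun i r => e * (-v (σ r) / d + l i * u (σ r)),
    ⟨fun i r _ => exp_pos _, fun i r hr => ?_, fun i r hr => ?_, ?_, fun i => ?_, fun i => ?_⟩⟩
  · have hp := hpos _ (hσI r hr)
    have h := ((((((hu (σ r)).comp r (hσd r hr)).log hp.ne').add_const
      (∑ k, log (a k))).div_const (d:ℝ)).const_sub (log (a i))).add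
      ((hσd r hr).const_mul (l i)) |>.exp
    refine HasDerivAt.hasDerivWithinAt ?_
    refine (h).congr_deriv ?_
    simp only [Function.comp, Pi.add_apply]
    congr 1
    field_simp
  · have h := (((((hv (σ r)).comp r (hσd r hr)).neg.div_const (d:ℝ)).add
      (((hu (σ r)).comp r (hσd r hr)).const_mul (l i))).const_mul e)
    refine HasDerivAt.hasDerivWithinAt ?_
    refine (h).congr_deriv ?_
    rw [hsum, ← hcons (σ r)]
    field_simp
    ring
  · rw [hsum]
    simp only [mul_pow, ← Finset.mul_sum, sum_sq_add_const l hl0, hkl, hσ0]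
    field_simp
    ring
  · simp [hσ0, hu0, exp_log (ha i)]
  · simp only [hσ1, hu1, log_exp, hl, logDev]
    rw [← exp_log (hb i)]
    congr 1
    rw [log_exp]
    ring

/-- Every solution is the same explicit function of a reparametrised time, provided by the
primitive `U` of `1/u`. -/
lemma LogSystem.exists_reparametrisation {d : ℕ} (hd : 2 ≤ d) {a b : Fin d → ℝ} {lam : ℝ}
    {f p : Fin d → ℝ → ℝ} (h : LogSystem d a b lam f p) {u v U : ℝ → ℝ}
    (hu : ∀ s, HasDerivAt u (v s) s) (hv : ∀ s, HasDerivAt v (volRate a b * u s) s)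
    (hu0 : u 0 = exp (-∑ k, log (a k))) (hu1 : u 1 = exp (-∑ k, log (b k)))
    (hU0 : U 0 = 0)
    (hUd : ∀ s ∈ Icc (0:ℝ) 1, HasDerivAt U (u s)⁻¹ s) :
    ∃ σ : ℝ → ℝ, ∀ r ∈ Icc (0:ℝ) 1, U (σ r) = r * U 1 ∧ ∀ i,
      log (f i r) = log (a i) - (log (u (σ r)) + ∑ k, log (a k)) / d + logDev a b i * σ r := by
  have hd2 : (2:ℝ) ≤ d := by exact_mod_cast hd
  have hd0 : (d:ℝ) ≠ 0 := by linarith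
  have hd1 : (d:ℝ) - 1 ≠ 0 := by linarith
  have h0I : (0:ℝ) ∈ Icc (0:ℝ) 1 := left_mem_Icc.2 zero_le_one
  have h1I : (1:ℝ) ∈ Icc (0:ℝ) 1 := right_mem_Icc.2 zero_le_one
  set S : ℝ → ℝ := fun r => ∑ k, p k r with hS
  set X : ℝ → ℝ := fun r => ∑ k, log (f k r) with hX
  set w : ℝ → ℝ := fun r => exp (-X r) with hw
  have hw0 : ∀ r, 0 < w r := fun r => exp_pos _
  have hlogd : ∀ i, ∀ r ∈ Icc (0:ℝ) 1,
      HasDerivWithinAt (fun r => log (f i r)) (p i r) (Icc 0 1) r := by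
    intro i r hr
    have hp := (h.pos i r hr).ne'
    refine ((h.deriv_f i r hr).log hp).congr_deriv ?_
    field_simp
  have hXd : ∀ r ∈ Icc (0:ℝ) 1, HasDerivWithinAt X (S r) (Icc 0 1) r := fun r hr =>
    HasDerivWithinAt.fun_sum fun i _ => hlogd i r hr
  have hSd : ∀ r ∈ Icc (0:ℝ) 1,
      HasDerivWithinAt S (-(d * lam) - S r ^ 2) (Icc 0 1) r := by
    intro r hr
    refine (HasDerivWithinAt.fun_sum (u := Finset.univ) fun i _ => h.deriv_p i r hr).congr_deriv ?_
    rw [Finset.sum_sub_distrib, ← Finset.sum_mul]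
    simp [hS]
    ring
  have hwd : ∀ r ∈ Icc (0:ℝ) 1, HasDerivWithinAt w (-S r * w r) (Icc 0 1) r := by
    intro r hr
    refine ((hXd r hr).neg.exp).congr_deriv ?_
    simp only [hw, Pi.neg_apply]
    ring
  have hwc : ContinuousOn w (Icc 0 1) := fun r hr => (hwd r hr).continuousWithinAt
  set T := ∫ t in (0:ℝ)..1, w t with hT
  have hT0 : 0 < T := intervalIntegral.intervalIntegral_pos_of_pos_on
    (by apply ContinuousOn.intervalIntegrable; rwa [uIcc_of_le zero_le_one])
    (fun r _ => hw0 r) zero_lt_one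
  set σ : ℝ → ℝ := fun r => (∫ t in (0:ℝ)..r, w t) / T with hσ
  have hσd : ∀ r ∈ Icc (0:ℝ) 1, HasDerivWithinAt σ (w r / T) (Icc 0 1) r := by
    intro r hr
    have : Fact (r ∈ Icc (0:ℝ) 1) := ⟨hr⟩
    refine HasDerivWithinAt.div_const ?_ T
    apply intervalIntegral.integral_hasDerivWithinAt_right
    · apply ContinuousOn.intervalIntegrable
      rw [uIcc_of_le hr.1]
      exact hwc.mono (Icc_subset_Icc_right hr.2)
    · exact hwc.stronglyMeasurableAtFilter_nhdsWithin measurableSet_Icc r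
    · exact hwc r hr
  have hσ0 : σ 0 = 0 := by simp [hσ]
  have hσ1 : σ 1 = 1 := by simp [hσ, ← hT, hT0.ne']
  have hσm : MonotoneOn σ (Icc 0 1) := by
    apply monotoneOn_of_hasDerivWithinAt_nonneg (convex_Icc 0 1) (f' := fun r => w r / T)
    · exact fun r hr => (hσd r hr).continuousWithinAt
    · exact fun r hr => (hσd r (interior_subset hr)).mono interior_subset
    · exact fun r _ => (div_pos (hw0 r) hT0).le
  have hσI : ∀ r ∈ Icc (0:ℝ) 1, σ r ∈ Icc (0:ℝ) 1 := fun r hr =>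
    ⟨hσ0 ▸ hσm h0I hr hr.1, hσ1 ▸ hσm hr h1I hr.2⟩
  have hc : ∀ i, ∀ r ∈ Icc (0:ℝ) 1, (p i r - S r / d) / w r = (p i 0 - S 0 / d) / w 0 := by
    intro i
    apply eq_left_of_hasDerivWithinAt_zero
    intro r hr
    refine ((((h.deriv_p i r hr).sub ((hSd r hr).div_const (d:ℝ))).div (hwd r hr)
      (hw0 r).ne')).congr_deriv ?_
    have := (hw0 r).ne'
    simp only [Pi.sub_apply]
    field_simp
    ring
  have hdev : ∀ i, ∀ r ∈ Icc (0:ℝ) 1, log (f i r) - X r / d -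
      (p i 0 - S 0 / d) / w 0 * T * σ r = log (a i) - (∑ k, log (a k)) / d := by
    intro i r hr
    have := eq_left_of_hasDerivWithinAt_zero (y := fun r => log (f i r) - X r / d -
      (p i 0 - S 0 / d) / w 0 * T * σ r) (fun r hr => ?_) r hr
    · simpa [hσ0, hX, h.left] using this
    · refine ((((hlogd i r hr).sub ((hXd r hr).div_const (d:ℝ))).sub
        ((hσd r hr).const_mul ((p i 0 - S 0 / d) / w 0 * T)))).congr_deriv ?_
      rw [← hc i r hr]
      have := (hw0 r).ne'
      field_simp
      ring
  have hl : ∀ i, (p i 0 - S 0 / d) / w 0 * T = logDev a b i := by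
    intro i
    have := hdev i 1 h1I
    simp only [hσ1, hX, h.right, mul_one] at this
    rw [logDev]
    linear_combination -this
  have hE : ∀ r ∈ Icc (0:ℝ) 1,
      (S r ^ 2 + d * lam) / w r ^ 2 = (S 0 ^ 2 + d * lam) / w 0 ^ 2 := by
    apply eq_left_of_hasDerivWithinAt_zero
    intro r hr
    refine (((((hSd r hr).pow 2).add_const (d * lam)).div ((hwd r hr).pow 2)
      (pow_ne_zero 2 (hw0 r).ne'))).congr_deriv ?_
    have := (hw0 r).ne'
    field_simp
    norm_num
    ring
  have hk : T ^ 2 * ((S 0 ^ 2 + d * lam) / w 0 ^ 2) = volRate a b := by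
    have hl0 : ∑ i, logDev a b i = 0 := sum_logDev (by omega) a b
    have hp : ∀ i, p i 0 = S 0 / d + logDev a b i * (w 0 / T) := by
      intro i
      rw [← hl i]
      have := (hw0 0).ne'
      field_simp
      ring
    have hi := h.init
    change _ - S 0 ^ 2 = _ at hi
    simp only [hp, sum_sq_add_const _ hl0] at hi
    have := (hw0 0).ne'
    rw [volRate]
    field_simp at hi ⊢
    linear_combination -hi
  have hwu : ∀ r ∈ Icc (0:ℝ) 1, w r = u (σ r) := by
    intro r hr
    refine sub_eq_zero.1 (dirichlet_eq_zero (y := fun r => w r - u (σ r))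
      (z := fun r => -(T * S r) - v (σ r)) (g := fun r => w r / T) (volRate_nonneg hd a b)
      (fun r _ => div_pos (hw0 r) hT0) (fun r hr => ?_) (fun r hr => ?_) ?_ ?_ r hr)
    · refine ((hwd r hr).sub ((hu (σ r)).comp_hasDerivWithinAt r (hσd r hr))).congr_deriv ?_
      field_simp
    · refine (((hSd r hr).const_mul T).neg.sub
        ((hv (σ r)).comp_hasDerivWithinAt r (hσd r hr))).congr_deriv ?_
      have hkr := hk
      rw [← hE r hr] at hkr
      have h1 : volRate a b * w r ^ 2 = T ^ 2 * (S r ^ 2 + d * lam) := by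
        rw [← hkr]
        have := (hw0 r).ne'
        field_simp
      field_simp
      linear_combination -h1
    · simp [hσ0, hu0, hw, hX, h.left]
    · simp [hσ1, hu1, hw, hX, h.right]
  have hUσ : ∀ r ∈ Icc (0:ℝ) 1, U (σ r) - r / T = 0 := by
    intro r hr
    have := eq_left_of_hasDerivWithinAt_zero (y := fun r => U (σ r) - r / T)
      (fun r hr => ?_) r hr
    · simpa [hσ0, hU0] using this
    · refine (((hUd (σ r) (hσI r hr)).comp_hasDerivWithinAt r (hσd r hr)).sub
        ((hasDerivWithinAt_id r _).div_const T)).congr_deriv ?_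
      rw [← hwu r hr]
      have := (hw0 r).ne'
      field_simp
      ring
  refine ⟨σ, fun r hr => ⟨?_, fun i => ?_⟩⟩
  · have h1 := hUσ 1 h1I
    rw [hσ1] at h1
    linear_combination hUσ r hr - r * h1
  · rw [← hwu r hr, ← hl i, hw, log_exp]
    have := hdev i r hr
    rw [add_div, neg_div]
    linarith

lemma TorusEinstein.eqOn {d : ℕ} (hd : 2 ≤ d) {a b : Fin d → ℝ} {lam₁ lam₂ : ℝ}
    {f₁ f₂ : Fin d → ℝ → ℝ} (h₁ : TorusEinstein d a b lam₁ f₁)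
    (h₂ : TorusEinstein d a b lam₂ f₂) (i : Fin d) : EqOn (f₁ i) (f₂ i) (Icc 0 1) := by
  obtain ⟨u, v, hu, hv, hu0, hu1, hpos⟩ := exists_dirichlet_solution (volRate_nonneg hd a b)
    (exp_pos (-∑ k, log (a k))) (exp_pos (-∑ k, log (b k)))
  obtain ⟨U, -, hU0, hmono, -, hUd, -⟩ := exists_primitive_inv
    (fun s _ => (hu s).continuousAt.continuousWithinAt) hpos
  obtain ⟨σ₁, hσ₁⟩ :=
    h₁.logSystem.exists_reparametrisation hd hu hv hu0 hu1 hU0 hUd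
  obtain ⟨σ₂, hσ₂⟩ :=
    h₂.logSystem.exists_reparametrisation hd hu hv hu0 hu1 hU0 hUd
  intro r hr
  have hσ : σ₁ r = σ₂ r := hmono.injective ((hσ₁ r hr).1.trans (hσ₂ r hr).1.symm)
  refine log_injOn_pos (h₁.2.1 i r hr) (h₂.2.1 i r hr) ?_
  rw [(hσ₁ r hr).2 i, (hσ₂ r hr).2 i, hσ]

/-- The Einstein constant is determined by the metric. -/
lemma TorusEinstein.lam_eq {d : ℕ} (hd : 2 ≤ d) {a b : Fin d → ℝ} {lam₁ lam₂ : ℝ}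
    {f₁ f₂ : Fin d → ℝ → ℝ} (h₁ : TorusEinstein d a b lam₁ f₁)
    (h₂ : TorusEinstein d a b lam₂ f₂) (h : ∀ i, EqOn (f₁ i) (f₂ i) (Icc 0 1)) :
    lam₁ = lam₂ := by
  have h0I : (0:ℝ) ∈ Icc (0:ℝ) 1 := left_mem_Icc.2 zero_le_one
  have hder : ∀ i, EqOn (derivWithin (f₁ i) (Icc 0 1)) (derivWithin (f₂ i) (Icc 0 1)) (Icc 0 1) :=
    fun i r hr => derivWithin_congr (h i) (h i hr)
  have i : Fin d := ⟨0, by omega⟩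
  rw [← h₁.2.2.2.1 i 0 h0I, ← h₂.2.2.2.1 i 0 h0I, derivWithin_congr (hder i) (hder i h0I)]
  simp only [hder _ h0I, h _ h0I]

theorem stmt_15 (d : ℕ) (hd : 2 ≤ d) (a b : Fin d → ℝ)
    (ha : ∀ i, 0 < a i) (hb : ∀ i, 0 < b i) :
    (∃ (lam : ℝ) (f : Fin d → ℝ → ℝ), TorusEinstein d a b lam f) ∧
    (∀ (lam₁ lam₂ : ℝ) (f₁ f₂ : Fin d → ℝ → ℝ),
      TorusEinstein d a b lam₁ f₁ → TorusEinstein d a b lam₂ f₂ →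
      lam₁ = lam₂ ∧ ∀ i, Set.EqOn (f₁ i) (f₂ i) (Set.Icc 0 1)) := by
  refine ⟨?_, fun lam₁ lam₂ f₁ f₂ h₁ h₂ => ?_⟩
  · obtain ⟨lam, f, p, h⟩ := exists_logSystem hd ha hb
    exact ⟨lam, f, h.torusEinstein⟩
  · exact ⟨h₁.lam_eq hd h₂ (h₁.eqOn hd h₂), h₁.eqOn hd h₂⟩
end

section
/- Let d ≥ 2 and R > 0. There exists R' > 0, depending only on d and R, such that: whenever D₁,...,D_d ∈ ℝ satisfy |D_i| ≤ R for all i, and (λ, L) is the unique solution of the system L_i' = -(Σ_k L_k)L_i - λ on [0,1], ∫₀¹ L_i = D_i, and Σ_i L_i(0)² - (Σ_i L_i(0))² = (d-1)λ, then |λ| < R' and sup_{r∈[0,1]} |L_i(r)| < R' for every i. -/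
open Real Set

lemma intervalIntegrable_of_continuousOn_unit {f : ℝ → ℝ} (hf : ContinuousOn f (Icc 0 1))
    {a b : ℝ} (ha : a ∈ Icc (0 : ℝ) 1) (hb : b ∈ Icc (0 : ℝ) 1) :
    IntervalIntegrable f MeasureTheory.volume a b :=
  (hf.mono (uIcc_subset_Icc ha hb)).intervalIntegrable

lemma hasDerivWithinAt_integral_of_continuousOn_unit {f : ℝ → ℝ}
    (hf : ContinuousOn f (Icc 0 1)) {r : ℝ} (hr : r ∈ Icc (0 : ℝ) 1) :
    HasDerivWithinAt (fun x => ∫ t in (0 : ℝ)..x, f t) (f r) (Icc 0 1) r := by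
  have hF : Continuous (IccExtend (zero_le_one' ℝ) (domRestrict (Icc 0 1) f)) :=
    hf.domRestrict.Icc_extend'
  have hEq : ∀ x ∈ Icc (0 : ℝ) 1, IccExtend (zero_le_one' ℝ) (domRestrict (Icc 0 1) f) x = f x :=
    fun x hx => IccExtend_of_mem _ _ hx
  have h := (hF.integral_hasStrictDerivAt 0 r).hasDerivAt.hasDerivWithinAt (s := Icc 0 1)
  rw [hEq r hr] at h
  have hI : ∀ x ∈ Icc (0 : ℝ) 1, ∫ t in (0 : ℝ)..x, f t =
      ∫ t in (0 : ℝ)..x, IccExtend (zero_le_one' ℝ) (domRestrict (Icc 0 1) f) t := fun x hx =>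
    intervalIntegral.integral_congr fun t ht =>
      (hEq t (uIcc_subset_Icc (left_mem_Icc.2 zero_le_one) hx ht)).symm
  exact h.congr hI (hI r hr)

/-- Solutions of a scalar homogeneous linear equation on the unit interval. -/
lemma eq_mul_exp_of_hasDerivWithinAt {A p P : ℝ → ℝ}
    (hA : ∀ r ∈ Icc (0 : ℝ) 1, HasDerivWithinAt A (p r * A r) (Icc 0 1) r)
    (hP : ∀ r ∈ Icc (0 : ℝ) 1, HasDerivWithinAt P (p r) (Icc 0 1) r) (hP0 : P 0 = 0)
    {r : ℝ} (hr : r ∈ Icc (0 : ℝ) 1) : A r = A 0 * exp (P r) := by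
  have hd : ∀ x ∈ Icc (0 : ℝ) 1,
      HasDerivWithinAt (fun x => A x * exp (-P x)) 0 (Icc 0 1) x := fun x hx => by
    refine HasDerivWithinAt.congr_deriv ((hA x hx).mul (hP x hx).fun_neg.exp) ?_
    ring
  have h := constant_of_derivWithin_zero (fun x hx => (hd x hx).differentiableWithinAt)
    (fun x hx => (hd x (Ico_subset_Icc_self hx)).derivWithin
      (uniqueDiffOn_Icc zero_lt_one x (Ico_subset_Icc_self hx))) r hr
  simp only [hP0, neg_zero, exp_zero, mul_one] at h
  rw [← h, mul_assoc, ← exp_add, neg_add_cancel, exp_zero, mul_one]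

/-- A solution of `A' = p A` on the unit interval is bounded by its mean, up to a factor depending
only on the `L¹` norm of `p`. -/
lemma abs_le_of_linear_of_integral_le {A p : ℝ → ℝ} {C M : ℝ}
    (hA : ∀ r ∈ Icc (0 : ℝ) 1, HasDerivWithinAt A (p r * A r) (Icc 0 1) r)
    (hp : ContinuousOn p (Icc 0 1)) (hC : ∫ t in (0 : ℝ)..1, |p t| ≤ C)
    (hM : |∫ t in (0 : ℝ)..1, A t| ≤ M) {r : ℝ} (hr : r ∈ Icc (0 : ℝ) 1) :
    |A r| ≤ M * exp C := by
  have h0 : (0 : ℝ) ∈ Icc (0 : ℝ) 1 := left_mem_Icc.2 zero_le_one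
  have h1 : (1 : ℝ) ∈ Icc (0 : ℝ) 1 := right_mem_Icc.2 zero_le_one
  set P : ℝ → ℝ := fun x => ∫ t in (0 : ℝ)..x, p t with hPdef
  have hP : ∀ x ∈ Icc (0 : ℝ) 1, HasDerivWithinAt P (p x) (Icc 0 1) x := fun x hx =>
    hasDerivWithinAt_integral_of_continuousOn_unit hp hx
  have hsol : ∀ x ∈ Icc (0 : ℝ) 1, A x = A 0 * exp (P x) := fun x hx =>
    eq_mul_exp_of_hasDerivWithinAt hA hP (by simp [hPdef]) hx
  have hPc : ContinuousOn (fun x => exp (P x)) (Icc 0 1) := fun x hx =>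
    (hP x hx).exp.continuousWithinAt
  have hosc : ∀ x ∈ Icc (0 : ℝ) 1, P r - C ≤ P x := fun x hx => by
    have hsub : P r - P x = ∫ t in x..r, p t :=
      intervalIntegral.integral_interval_sub_left
        (intervalIntegrable_of_continuousOn_unit hp h0 hr)
        (intervalIntegrable_of_continuousOn_unit hp h0 hx)
    have hle : |∫ t in x..r, p t| ≤ ∫ t in (0 : ℝ)..1, |p t| := by
      refine (intervalIntegral.norm_integral_le_abs_integral_norm (f := p)).trans ?_
      have h := intervalIntegral.abs_integral_mono_interval (μ := MeasureTheory.volume)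
        (f := fun t => |p t|) (a := x) (b := r) (c := 0) (d := 1)
        (by rw [uIoc_of_le zero_le_one]
            exact fun t ht => ⟨(le_min hx.1 hr.1).trans_lt ht.1, ht.2.trans (max_le hx.2 hr.2)⟩)
        (Filter.Eventually.of_forall fun t => abs_nonneg (p t))
        (intervalIntegrable_of_continuousOn_unit hp.abs h0 h1)
      exact h.trans_eq (abs_of_nonneg
        (intervalIntegral.integral_nonneg zero_le_one fun t _ => abs_nonneg _))
    linarith [le_abs_self (∫ t in x..r, p t)]
  have hint : ∫ t in (0 : ℝ)..1, A t = A 0 * ∫ t in (0 : ℝ)..1, exp (P t) := by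
    rw [← intervalIntegral.integral_const_mul]
    exact intervalIntegral.integral_congr fun t ht => hsol t (uIcc_subset_Icc h0 h1 ht)
  have hlow : exp (P r - C) ≤ ∫ t in (0 : ℝ)..1, exp (P t) := by
    have h := intervalIntegral.integral_mono_on (μ := MeasureTheory.volume) zero_le_one
      (f := fun _ => exp (P r - C)) (g := fun t => exp (P t)) intervalIntegrable_const
      (intervalIntegrable_of_continuousOn_unit hPc h0 h1) fun t ht => exp_le_exp.2 (hosc t ht)
    simpa using h
  rw [hint, abs_mul, abs_of_pos ((exp_pos _).trans_le hlow)] at hM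
  calc |A r| = |A 0| * exp (P r - C) * exp C := by
        rw [hsol r hr, abs_mul, abs_of_pos (exp_pos _), mul_assoc, ← exp_add, sub_add_cancel]
    _ ≤ M * exp C := by
        gcongr
        exact (mul_le_mul_of_nonneg_left hlow (abs_nonneg _)).trans hM

theorem stmt_16 (d : ℕ) (hd : 2 ≤ d) (R : ℝ) (hR : 0 < R) :
    ∃ R' : ℝ, 0 < R' ∧
      ∀ (Di : Fin d → ℝ), (∀ i, |Di i| ≤ R) →
        ∀ (lam : ℝ) (L : Fin d → ℝ → ℝ),
          (∀ i, ContDiffOn ℝ 1 (L i) (Set.Icc 0 1)) →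
          (∀ i, ∀ r ∈ Set.Icc (0:ℝ) 1,
            HasDerivWithinAt (L i) (-(∑ k, L k r) * L i r - lam) (Set.Icc 0 1) r) →
          (∀ i, ∫ r in (0:ℝ)..1, L i r = Di i) →
          ((∑ i, (L i 0) ^ 2) - (∑ i, L i 0) ^ 2 = (d - 1) * lam) →
          |lam| < R' ∧ ∀ i, ∀ r ∈ Set.Icc (0:ℝ) 1, |L i r| < R' := by
  have hd' : (2 : ℝ) ≤ d := by exact_mod_cast hd
  have hdpos : (0 : ℝ) < d := by linarith
  set C : ℝ := 4 * d * R
  set K : ℝ := (C + d * R) * exp C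
  have hK : 0 < K := by positivity
  refine ⟨K ^ 2 + 2 * K + 1, by positivity, ?_⟩
  intro Di hDi lam L hL hODE hint hcon
  have h0 : (0 : ℝ) ∈ Icc (0 : ℝ) 1 := left_mem_Icc.2 zero_le_one
  have h1 : (1 : ℝ) ∈ Icc (0 : ℝ) 1 := right_mem_Icc.2 zero_le_one
  have hLc : ∀ i, ContinuousOn (L i) (Icc 0 1) := fun i => (hL i).continuousOn
  set H : ℝ → ℝ := fun r => ∑ k, L k r with hHdef
  have hHc : ContinuousOn H (Icc 0 1) := continuousOn_finsetSum _ fun i _ => hLc i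
  have hH : ∀ r ∈ Icc (0 : ℝ) 1, HasDerivWithinAt H (-H r ^ 2 - d * lam) (Icc 0 1) r := by
    intro r hr
    refine HasDerivWithinAt.congr_deriv (HasDerivWithinAt.fun_sum (u := Finset.univ) fun i _ => hODE i r hr) ?_
    simp only [Finset.sum_sub_distrib, ← Finset.mul_sum, Finset.sum_const, Finset.card_univ,
      Fintype.card_fin, nsmul_eq_mul, hHdef]
    ring
  set G : ℝ → ℝ := fun x => ∫ t in (0 : ℝ)..x, H t with hGdef
  have hG : ∀ r ∈ Icc (0 : ℝ) 1, HasDerivWithinAt G (H r) (Icc 0 1) r := fun r hr =>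
    hasDerivWithinAt_integral_of_continuousOn_unit hHc hr
  have hG0 : G 0 = 0 := by simp [hGdef]
  have hec : ContinuousOn (fun r => exp (-G r)) (Icc 0 1) := fun r hr =>
    (hG r hr).neg.exp.continuousWithinAt
  set s : Fin d → ℝ := fun i => L i 0 - H 0 / d with hsdef
  have hshear : ∀ i, ∀ r ∈ Icc (0 : ℝ) 1, L i r - H r / d = s i * exp (-G r) := fun i r hr => by
    refine eq_mul_exp_of_hasDerivWithinAt (A := fun r => L i r - H r / d) (p := fun r => -H r)
      (P := fun r => -G r) (fun x hx => ?_) (fun x hx => (hG x hx).neg) (by simp [hG0]) hr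
    refine HasDerivWithinAt.congr_deriv ((hODE i x hx).sub ((hH x hx).div_const (d : ℝ))) ?_
    simp only [hHdef]
    field_simp
    ring
  have hs2 : (d - 1) * (H 0 ^ 2 + d * lam) = d * ∑ i, s i ^ 2 := by
    have : ∑ i, s i ^ 2 = (∑ i, L i 0 ^ 2) - H 0 ^ 2 / d := by
      simp only [hsdef, sub_sq, Finset.sum_add_distrib, Finset.sum_sub_distrib, ← Finset.sum_mul,
        ← Finset.mul_sum, Finset.sum_const, Finset.card_univ, Fintype.card_fin, nsmul_eq_mul]
      simp only [hHdef]
      field_simp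
      ring
    rw [this]
    change (∑ i, L i 0 ^ 2) - H 0 ^ 2 = (d - 1) * lam at hcon
    field_simp
    linear_combination (-(d : ℝ)) * hcon
  have hE : 0 ≤ H 0 ^ 2 + d * lam := by
    have : 0 ≤ ∑ i, s i ^ 2 := Finset.sum_nonneg fun i _ => sq_nonneg _
    nlinarith
  set c : ℝ := √(H 0 ^ 2 + d * lam)
  have hc0 : 0 ≤ c := sqrt_nonneg _
  have hc2 : c ^ 2 = H 0 ^ 2 + d * lam := sq_sqrt hE
  have hsc2 : ∑ i, s i ^ 2 ≤ c ^ 2 := by nlinarith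
  have hsc : ∀ i, |s i| ≤ c := fun i => abs_le_of_sq_le_sq
    ((Finset.single_le_sum (fun j _ => sq_nonneg (s j)) (Finset.mem_univ i)).trans hsc2) hc0
  have hcs : c ≤ 2 * ∑ i, |s i| := by
    have hsum : ∑ i, s i ^ 2 ≤ (∑ i, |s i|) ^ 2 := by
      simpa only [sq_abs] using
        Finset.sum_sq_le_sq_sum_of_nonneg (s := Finset.univ) fun i _ => abs_nonneg (s i)
    have : 0 ≤ ∑ i, |s i| := Finset.sum_nonneg fun i _ => abs_nonneg _
    have hss : 0 ≤ ∑ i, s i ^ 2 := Finset.sum_nonneg fun i _ => sq_nonneg _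
    refine le_of_sq_le_sq ?_ (by positivity)
    nlinarith
  set q : ℝ → ℝ := fun r => c * exp (-G r) with hqdef
  have hq0 : ∀ r, 0 ≤ q r := fun r => by positivity
  have hqc : ContinuousOn q (Icc 0 1) := continuousOn_const.mul hec
  have hq : ∀ r ∈ Icc (0 : ℝ) 1, HasDerivWithinAt q (-H r * q r) (Icc 0 1) r := fun r hr => by
    refine HasDerivWithinAt.congr_deriv ((hG r hr).fun_neg.exp.const_mul c) ?_
    simp only [hqdef]
    ring
  have hqH : ∀ r ∈ Icc (0 : ℝ) 1, H r ^ 2 + d * lam = q r ^ 2 := fun r hr => by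
    have h := eq_mul_exp_of_hasDerivWithinAt (A := fun r => H r ^ 2 + d * lam)
      (p := fun r => 2 * -H r) (P := fun r => 2 * -G r)
      (fun x hx => by
        refine HasDerivWithinAt.congr_deriv (((hH x hx).pow 2).add_const (d * lam)) ?_
        simp only [Nat.cast_ofNat, Nat.add_one_sub_one, pow_one]
        ring)
      (fun x hx => (hG x hx).neg.const_mul 2) (by simp [hG0]) hr
    rw [h, ← hc2, hqdef, mul_pow, ← exp_nat_mul, Nat.cast_ofNat]
  have hHint : |∫ t in (0 : ℝ)..1, H t| ≤ d * R := by
    rw [hHdef, intervalIntegral.integral_finsetSum fun i _ =>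
      intervalIntegrable_of_continuousOn_unit (hLc i) h0 h1]
    simp only [hint]
    refine (Finset.abs_sum_le_sum_abs _ _).trans ((Finset.sum_le_sum fun i _ => hDi i).trans ?_)
    simp
  have hHi := intervalIntegrable_of_continuousOn_unit hHc h0 h1
  have hqi := intervalIntegrable_of_continuousOn_unit hqc h0 h1
  have hI0 : 0 ≤ ∫ t in (0 : ℝ)..1, exp (-G t) :=
    intervalIntegral.integral_nonneg zero_le_one fun t _ => (exp_pos _).le
  have hsint : ∀ i, |s i| * ∫ t in (0 : ℝ)..1, exp (-G t) ≤ 2 * R := fun i => by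
    have h : s i * ∫ t in (0 : ℝ)..1, exp (-G t) = Di i - (∫ t in (0 : ℝ)..1, H t) / d := by
      rw [← intervalIntegral.integral_const_mul, ← hint i, ← intervalIntegral.integral_div,
        ← intervalIntegral.integral_sub
          (intervalIntegrable_of_continuousOn_unit (hLc i) h0 h1) (hHi.div_const _)]
      exact intervalIntegral.integral_congr fun t ht =>
        (hshear i t (uIcc_subset_Icc h0 h1 ht)).symm
    rw [← abs_of_nonneg hI0, ← abs_mul, h]
    have hdiv : |(∫ t in (0 : ℝ)..1, H t) / d| ≤ R := by
      rw [abs_div, abs_of_pos hdpos, div_le_iff₀ hdpos]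
      linarith
    linarith [abs_sub (Di i) ((∫ t in (0 : ℝ)..1, H t) / d), hDi i]
  have hqint : ∫ t in (0 : ℝ)..1, q t ≤ C := by
    rw [hqdef, intervalIntegral.integral_const_mul]
    refine (mul_le_mul_of_nonneg_right hcs hI0).trans ?_
    rw [mul_assoc, Finset.sum_mul]
    have h := Finset.sum_le_sum fun i (_ : i ∈ Finset.univ) => hsint i
    simp only [Finset.sum_const, Finset.card_univ, Fintype.card_fin, nsmul_eq_mul] at h
    linarith
  have hqint0 : 0 ≤ ∫ t in (0 : ℝ)..1, q t :=
    intervalIntegral.integral_nonneg zero_le_one fun t _ => hq0 t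
  have hadd : ∀ r ∈ Icc (0 : ℝ) 1, |q r + H r| ≤ K := fun r hr => by
    refine abs_le_of_linear_of_integral_le (A := fun r => q r + H r) (p := fun r => -q r)
      (fun x hx => ?_) hqc.neg (by simpa only [abs_neg, abs_of_nonneg (hq0 _)]) ?_ hr
    · refine HasDerivWithinAt.congr_deriv ((hq x hx).add (hH x hx)) ?_
      linear_combination (-1 : ℝ) * hqH x hx
    · rw [intervalIntegral.integral_add hqi hHi]
      rw [abs_le] at hHint ⊢
      constructor <;> linarith [hHint.1, hHint.2]
  have hsub : ∀ r ∈ Icc (0 : ℝ) 1, |q r - H r| ≤ K := fun r hr => by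
    refine abs_le_of_linear_of_integral_le (A := fun r => q r - H r) (p := q)
      (fun x hx => ?_) hqc (by simpa only [abs_of_nonneg (hq0 _)]) ?_ hr
    · refine HasDerivWithinAt.congr_deriv ((hq x hx).sub (hH x hx)) ?_
      linear_combination hqH x hx
    · rw [intervalIntegral.integral_sub hqi hHi]
      rw [abs_le] at hHint ⊢
      constructor <;> linarith [hHint.1, hHint.2]
  constructor
  · have hprod : d * lam = (q 0 + H 0) * (q 0 - H 0) := by linear_combination hqH 0 h0
    have hle : d * |lam| ≤ K * K := by
      rw [← abs_of_pos hdpos, ← abs_mul, hprod, abs_mul]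
      exact mul_le_mul (hadd 0 h0) (hsub 0 h0) (abs_nonneg _) hK.le
    nlinarith [abs_nonneg lam]
  · intro i r hr
    have hqK : q r ≤ K := by
      linarith [(abs_le.1 (hadd r hr)).2, (abs_le.1 (hsub r hr)).2]
    have hHK : |H r| ≤ K := by
      have h2 := abs_le.1 (hadd r hr)
      have h3 := abs_le.1 (hsub r hr)
      exact abs_le.2 ⟨by linarith, by linarith⟩
    have hHd : |H r / d| ≤ K := by
      rw [abs_div, abs_of_pos hdpos, div_le_iff₀ hdpos]
      nlinarith
    have hσ : |L i r - H r / d| ≤ K := by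
      rw [hshear i r hr, abs_mul, abs_of_pos (exp_pos _)]
      exact (mul_le_mul_of_nonneg_right (hsc i) (exp_pos _).le).trans hqK
    have := abs_add_le (L i r - H r / d) (H r / d)
    rw [sub_add_cancel] at this
    nlinarith
end
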